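/- Let ℓ satisfy Assumption A and define ρ : ℝ² → ℝ by ρ(ε, w) = ε² ℓ(−w/ε²) if ε ≠ 0 and ρ(0, w) = max{−w, 0}. Then ρ has continuous first partial derivatives at every point (ε, w) except (0, 0); moreover the second partial derivatives ∂²ρ/∂w², ∂²ρ/∂ε∂w, and ∂²ρ/∂w∂ε are continuous everywhere except at (ε, w) = (0, 0), and ∂²ρ/∂ε² is continuous on the set {(ε, w) : w > 0}. -/

import Mathlib

open Filter Topology

/-- Assumption A on the individual loss function `ℓ`:
(i) `ℓ` is nonnegative, three-times continuously differentiable, strictly convex,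
and tends to `0` at `-∞`;
(ii) `ℓ'` tends to `0` at `-∞` and to `1` at `+∞`;
(iii) `ℓ''` is increasing on `(-∞, 0]`, decreasing on `[0, ∞)`, and
`(1/ε²)·ℓ''(1/ε) → 0` as `ε → 0`. -/
structure AssumptionA (ℓ : ℝ → ℝ) : Prop where
  nonneg : ∀ z, 0 ≤ ℓ z
  smooth : ContDiff ℝ 3 ℓ
  strictConvex : StrictConvexOn ℝ Set.univ ℓ
  tendsto_zero_atBot : Tendsto ℓ atBot (𝓝 0)
  deriv_tendsto_zero_atBot : Tendsto (deriv ℓ) atBot (𝓝 0)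
  deriv_tendsto_one_atTop : Tendsto (deriv ℓ) atTop (𝓝 1)
  secondDeriv_strictMono : StrictMonoOn (deriv (deriv ℓ)) (Set.Iic 0)
  secondDeriv_strictAnti : StrictAntiOn (deriv (deriv ℓ)) (Set.Ici 0)
  secondDeriv_decay :
    Tendsto (fun ε : ℝ => (1 / ε ^ 2) * deriv (deriv ℓ) (1 / ε)) (𝓝[≠] (0 : ℝ)) (𝓝 0)

open Asymptotics

lemma AssumptionA.hasDerivAt {ℓ : ℝ → ℝ} (hA : AssumptionA ℓ) (x : ℝ) :
    HasDerivAt ℓ (deriv ℓ x) x :=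
  (hA.smooth.differentiable (by norm_num) x).hasDerivAt

lemma AssumptionA.contDiff_deriv {ℓ : ℝ → ℝ} (hA : AssumptionA ℓ) : ContDiff ℝ 2 (deriv ℓ) :=
  (contDiff_succ_iff_deriv.1 (show ContDiff ℝ (2 + 1) ℓ from hA.smooth)).2.2

lemma AssumptionA.hasDerivAt_deriv {ℓ : ℝ → ℝ} (hA : AssumptionA ℓ) (x : ℝ) :
    HasDerivAt (deriv ℓ) (deriv (deriv ℓ) x) x :=
  (hA.contDiff_deriv.differentiable (by norm_num) x).hasDerivAt

lemma AssumptionA.continuous_deriv_deriv {ℓ : ℝ → ℝ} (hA : AssumptionA ℓ) :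
    Continuous (deriv (deriv ℓ)) :=
  hA.contDiff_deriv.continuous_deriv (by norm_num)

lemma AssumptionA.hasDerivAt_sub_mul_deriv {ℓ : ℝ → ℝ} (hA : AssumptionA ℓ) (x : ℝ) :
    HasDerivAt (fun x => ℓ x - x * deriv ℓ x) (-(x * deriv (deriv ℓ) x)) x := by
  refine ((hA.hasDerivAt x).sub ((hasDerivAt_id x).mul (hA.hasDerivAt_deriv x))).congr_deriv ?_
  simp

lemma AssumptionA.tendsto_sq_mul_atTop {ℓ : ℝ → ℝ} (hA : AssumptionA ℓ) :
    Tendsto (fun x => x ^ 2 * deriv (deriv ℓ) x) atTop (𝓝 0) := by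
  have h : Tendsto (fun x : ℝ => x⁻¹) atTop (𝓝[≠] 0) :=
    tendsto_inv_atTop_nhdsGT_zero.mono_right (nhdsWithin_mono _ fun x hx => ne_of_gt hx)
  simpa [Function.comp_def] using hA.secondDeriv_decay.comp h

lemma AssumptionA.tendsto_sq_mul_atBot {ℓ : ℝ → ℝ} (hA : AssumptionA ℓ) :
    Tendsto (fun x => x ^ 2 * deriv (deriv ℓ) x) atBot (𝓝 0) := by
  have h : Tendsto (fun x : ℝ => x⁻¹) atBot (𝓝[≠] 0) :=
    tendsto_inv_atBot_nhdsLT_zero.mono_right (nhdsWithin_mono _ fun x hx => ne_of_lt hx)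
  simpa [Function.comp_def] using hA.secondDeriv_decay.comp h

/-- A function with derivative bounded below by `-a / x ^ 2` at infinity and limit `0` is
eventually at most `a / x`. -/
lemma eventually_le_div_of_neg_div_sq_le_deriv {f f' : ℝ → ℝ} (hf : ∀ x, HasDerivAt f (f' x) x)
    (h0 : Tendsto f atTop (𝓝 0)) {a : ℝ} (h : ∀ᶠ x in atTop, -a ≤ x ^ 2 * f' x) :
    ∀ᶠ x in atTop, f x ≤ a / x := by
  obtain ⟨M, hM⟩ := eventually_atTop.1 (h.and (eventually_gt_atTop 0))
  filter_upwards [eventually_ge_atTop M] with x hx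
  have hd : ∀ y ∈ Set.Ici M, HasDerivAt (fun y => f y - a * y⁻¹) (f' y - a * (-(y ^ 2)⁻¹)) y :=
    fun y hy => (hf y).sub ((hasDerivAt_inv (hM y hy).2.ne').const_mul a)
  have hmono : MonotoneOn (fun y => f y - a * y⁻¹) (Set.Ici M) := by
    refine monotoneOn_of_hasDerivWithinAt_nonneg (convex_Ici M)
      (fun y hy => (hd y hy).continuousAt.continuousWithinAt)
      (fun y hy => (hd y (interior_subset hy)).hasDerivWithinAt) fun y hy => ?_
    obtain ⟨h1, h2⟩ := hM y (interior_subset hy)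
    have h3 : f' y - a * (-(y ^ 2)⁻¹) = (y ^ 2 * f' y + a) / y ^ 2 := by
      field_simp
      ring
    rw [h3]
    exact div_nonneg (by linarith) (by positivity)
  have hlim : Tendsto (fun y => f y - a * y⁻¹) atTop (𝓝 0) := by
    simpa using h0.sub (tendsto_inv_atTop_zero.const_mul a)
  have := ge_of_tendsto hlim (b := f x - a * x⁻¹) (by
    filter_upwards [eventually_ge_atTop x] with y hy
    exact hmono hx (le_trans hx hy) hy)
  rw [div_eq_mul_inv]
  linarith

lemma tendsto_mul_atTop_of_tendsto_sq_mul_deriv {f f' : ℝ → ℝ}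
    (hf : ∀ x, HasDerivAt f (f' x) x) (h0 : Tendsto f atTop (𝓝 0))
    (h : Tendsto (fun x => x ^ 2 * f' x) atTop (𝓝 0)) :
    Tendsto (fun x => x * f x) atTop (𝓝 0) := by
  rw [Metric.tendsto_nhds]
  intro δ hδ
  have hb := (Metric.tendsto_nhds.1 h) (δ / 2) (by positivity)
  have h1 := eventually_le_div_of_neg_div_sq_le_deriv hf h0 (a := δ / 2) (by
    filter_upwards [hb] with x hx
    rw [Real.dist_eq, sub_zero, abs_lt] at hx
    exact hx.1.le)
  have h2 := eventually_le_div_of_neg_div_sq_le_deriv (f := fun x => -f x)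
    (fun x => (hf x).neg) (by simpa using h0.neg) (a := δ / 2) (by
    filter_upwards [hb] with x hx
    rw [Real.dist_eq, sub_zero, abs_lt] at hx
    linarith [hx.2])
  filter_upwards [h1, h2, eventually_gt_atTop 0] with x h1 h2 hx
  rw [le_div_iff₀ hx] at h1 h2
  rw [Real.dist_eq, sub_zero, abs_lt]
  constructor <;> linarith

/-- A function with derivative bounded below by `-1 / x` at infinity decreases at most
logarithmically. -/
lemma exists_eventually_sub_log_le {f f' : ℝ → ℝ} (hf : ∀ x, HasDerivAt f (f' x) x)
    (h : ∀ᶠ x in atTop, -1 ≤ x * f' x) :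
    ∃ C, ∀ᶠ x in atTop, C - Real.log x ≤ f x := by
  obtain ⟨M, hM⟩ := eventually_atTop.1 (h.and (eventually_gt_atTop 0))
  refine ⟨f M + Real.log M, ?_⟩
  filter_upwards [eventually_ge_atTop M] with x hx
  have hd : ∀ y ∈ Set.Ici M, HasDerivAt (fun y => f y + Real.log y) (f' y + y⁻¹) y :=
    fun y hy => (hf y).add (Real.hasDerivAt_log (hM y hy).2.ne')
  have hmono : MonotoneOn (fun y => f y + Real.log y) (Set.Ici M) := by
    refine monotoneOn_of_hasDerivWithinAt_nonneg (convex_Ici M)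
      (fun y hy => (hd y hy).continuousAt.continuousWithinAt)
      (fun y hy => (hd y (interior_subset hy)).hasDerivWithinAt) fun y hy => ?_
    obtain ⟨h1, h2⟩ := hM y (interior_subset hy)
    have h3 : f' y + y⁻¹ = (y * f' y + 1) / y := by
      field_simp
    rw [h3]
    exact div_nonneg (by linarith) h2.le
  have := hmono Set.self_mem_Ici hx hx
  simp only at this
  linarith

lemma isLittleO_sqrt_of_tendsto_mul_deriv {f f' : ℝ → ℝ} (hf : ∀ x, HasDerivAt f (f' x) x)
    (h : Tendsto (fun x => x * f' x) atTop (𝓝 0)) : f =o[atTop] Real.sqrt := by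
  have hb := (Metric.tendsto_nhds.1 h) 1 one_pos
  obtain ⟨C, hC⟩ := exists_eventually_sub_log_le hf (by
    filter_upwards [hb] with x hx
    rw [Real.dist_eq, sub_zero, abs_lt] at hx
    exact hx.1.le)
  obtain ⟨D, hD⟩ := exists_eventually_sub_log_le (fun x => (hf x).neg) (by
    filter_upwards [hb] with x hx
    rw [Real.dist_eq, sub_zero, abs_lt] at hx
    linarith [hx.2])
  have hO : f =O[atTop] fun x => |C| + |D| + Real.log x := by
    refine IsBigO.of_bound 1 ?_
    filter_upwards [hC, hD, eventually_ge_atTop 1] with x h1 h2 hx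
    have hl := Real.log_nonneg hx
    simp only [Pi.neg_apply] at h2
    rw [one_mul, Real.norm_eq_abs, Real.norm_eq_abs,
      abs_of_nonneg (by positivity : 0 ≤ |C| + |D| + Real.log x), abs_le]
    constructor <;> linarith [neg_abs_le C, neg_abs_le D, abs_nonneg C, abs_nonneg D]
  refine hO.trans_isLittleO (IsLittleO.add ?_ ?_)
  · refine isLittleO_const_left.2 (Or.inr ?_)
    exact tendsto_norm_atTop_atTop.comp Real.tendsto_sqrt_atTop
  · exact (isLittleO_log_rpow_atTop (r := 1 / 2) (by norm_num)).congr_right fun x =>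
      (Real.sqrt_eq_rpow x).symm

lemma AssumptionA.isLittleO_sub_mul_deriv {ℓ : ℝ → ℝ} (hA : AssumptionA ℓ) :
    (fun x => ℓ x - x * deriv ℓ x) =o[atTop] Real.sqrt := by
  refine isLittleO_sqrt_of_tendsto_mul_deriv hA.hasDerivAt_sub_mul_deriv ?_
  have := hA.tendsto_sq_mul_atTop.neg
  rw [neg_zero] at this
  exact this.congr fun x => by ring

lemma AssumptionA.tendsto_sub_mul_deriv_atBot {ℓ : ℝ → ℝ} (hA : AssumptionA ℓ) :
    Tendsto (fun x => ℓ x - x * deriv ℓ x) atBot (𝓝 0) := by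
  have h1 := tendsto_mul_atTop_of_tendsto_sq_mul_deriv (f := fun x => deriv ℓ (-x))
    (f' := fun x => -deriv (deriv ℓ) (-x))
    (fun x => ((hA.hasDerivAt_deriv (-x)).comp x (hasDerivAt_neg x)).congr_deriv (by ring))
    (hA.deriv_tendsto_zero_atBot.comp tendsto_neg_atTop_atBot) (by
      have := (hA.tendsto_sq_mul_atBot.comp tendsto_neg_atTop_atBot).neg
      rw [neg_zero] at this
      exact this.congr fun x => by simp)
  have h2 := hA.tendsto_zero_atBot.add (h1.comp tendsto_neg_atBot_atTop)
  rw [add_zero] at h2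
  exact h2.congr fun x => by simp [sub_eq_add_neg]

lemma tendsto_fst_sq_inv (w : ℝ) :
    Tendsto (fun q : ℝ × ℝ => (q.1 ^ 2)⁻¹) (𝓝[{q | q.1 ≠ 0}] (0, w)) atTop := by
  refine tendsto_inv_nhdsGT_zero.comp (tendsto_nhdsWithin_iff.2 ⟨?_, ?_⟩)
  · have : Continuous fun q : ℝ × ℝ => q.1 ^ 2 := by fun_prop
    simpa using (this.tendsto (0, w)).mono_left nhdsWithin_le_nhds
  · filter_upwards [self_mem_nhdsWithin] with q (hq : q.1 ≠ 0)
    exact Set.mem_Ioi.2 (by positivity)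

lemma tendsto_fst_nhdsWithin (w : ℝ) (s : Set (ℝ × ℝ)) :
    Tendsto (fun q : ℝ × ℝ => q.1) (𝓝[s] (0, w)) (𝓝 0) :=
  (continuous_fst.tendsto ((0 : ℝ), w)).mono_left nhdsWithin_le_nhds

lemma tendsto_snd_nhdsWithin (w : ℝ) (s : Set (ℝ × ℝ)) :
    Tendsto (fun q : ℝ × ℝ => q.2) (𝓝[s] (0, w)) (𝓝 w) :=
  (continuous_snd.tendsto ((0 : ℝ), w)).mono_left nhdsWithin_le_nhds

lemma tendsto_neg_snd_div_atTop {w : ℝ} (hw : w < 0) :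
    Tendsto (fun q : ℝ × ℝ => -q.2 / q.1 ^ 2) (𝓝[{q | q.1 ≠ 0}] (0, w)) atTop :=
  Tendsto.pos_mul_atTop (neg_pos.2 hw) (tendsto_snd_nhdsWithin w _).neg (tendsto_fst_sq_inv w)

lemma tendsto_neg_snd_div_atBot {w : ℝ} (hw : 0 < w) :
    Tendsto (fun q : ℝ × ℝ => -q.2 / q.1 ^ 2) (𝓝[{q | q.1 ≠ 0}] (0, w)) atBot :=
  Tendsto.neg_mul_atTop (neg_lt_zero.2 hw) (tendsto_snd_nhdsWithin w _).neg
    (tendsto_fst_sq_inv w)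

lemma AssumptionA.tendsto_sq_mul_comp {ℓ : ℝ → ℝ} (hA : AssumptionA ℓ) {w : ℝ} (hw : w ≠ 0) :
    Tendsto (fun q : ℝ × ℝ => (-q.2 / q.1 ^ 2) ^ 2 * deriv (deriv ℓ) (-q.2 / q.1 ^ 2))
      (𝓝[{q | q.1 ≠ 0}] (0, w)) (𝓝 0) := by
  rcases hw.lt_or_gt with hw | hw
  · exact hA.tendsto_sq_mul_atTop.comp (tendsto_neg_snd_div_atTop hw)
  · exact hA.tendsto_sq_mul_atBot.comp (tendsto_neg_snd_div_atBot hw)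

lemma AssumptionA.tendsto_deriv_comp {ℓ : ℝ → ℝ} (hA : AssumptionA ℓ) {w : ℝ} (hw : w ≠ 0) :
    Tendsto (fun q : ℝ × ℝ => deriv ℓ (-q.2 / q.1 ^ 2))
      (𝓝[{q | q.1 ≠ 0}] (0, w)) (𝓝 (if w < 0 then 1 else 0)) := by
  rcases hw.lt_or_gt with hw | hw
  · rw [if_pos hw]
    exact hA.deriv_tendsto_one_atTop.comp (tendsto_neg_snd_div_atTop hw)
  · rw [if_neg hw.not_gt]
    exact hA.deriv_tendsto_zero_atBot.comp (tendsto_neg_snd_div_atBot hw)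

lemma AssumptionA.tendsto_fst_mul_comp {ℓ : ℝ → ℝ} (hA : AssumptionA ℓ) {w : ℝ} (hw : w ≠ 0) :
    Tendsto (fun q : ℝ × ℝ => q.1 *
      (ℓ (-q.2 / q.1 ^ 2) - -q.2 / q.1 ^ 2 * deriv ℓ (-q.2 / q.1 ^ 2)))
      (𝓝[{q | q.1 ≠ 0}] (0, w)) (𝓝 0) := by
  rcases hw.lt_or_gt with hw | hw
  · have h1 := (isBigO_refl (fun q : ℝ × ℝ => q.1) _).mul_isLittleO
      (hA.isLittleO_sub_mul_deriv.comp_tendsto (tendsto_neg_snd_div_atTop hw))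
    have h2 : (fun q : ℝ × ℝ => q.1 * Real.sqrt (-q.2 / q.1 ^ 2))
        =O[𝓝[{q | q.1 ≠ 0}] (0, w)] fun _ => (1 : ℝ) := by
      have h3 : Tendsto (fun q : ℝ × ℝ => Real.sqrt (-q.2)) (𝓝[{q | q.1 ≠ 0}] (0, w))
          (𝓝 (Real.sqrt (-w))) := (tendsto_snd_nhdsWithin w _).neg.sqrt
      refine IsBigO.trans (IsBigO.of_bound 1 ?_) (h3.isBigO_one ℝ)
      filter_upwards [self_mem_nhdsWithin] with q (hq : q.1 ≠ 0)
      rw [Real.sqrt_div' _ (sq_nonneg _), Real.sqrt_sq_eq_abs, norm_mul, norm_div, norm_abs_eq_norm,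
        one_mul, mul_div_cancel₀ _ (norm_ne_zero_iff.2 hq)]
    exact (isLittleO_one_iff ℝ).1 (h1.trans_isBigO h2)
  · simpa using (tendsto_fst_nhdsWithin w _).mul
      (hA.tendsto_sub_mul_deriv_atBot.comp (tendsto_neg_snd_div_atBot hw))

lemma continuousAt_ite_fst_eq_zero_of_ne {F : ℝ × ℝ → ℝ} {c : ℝ × ℝ → ℝ} {p : ℝ × ℝ}
    (hp : p.1 ≠ 0) (h : ContinuousAt F p) :
    ContinuousAt (fun q : ℝ × ℝ => if q.1 = 0 then c q else F q) p := by
  refine h.congr ?_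
  filter_upwards [continuousAt_fst.eventually_ne hp] with q hq
  rw [if_neg hq]

lemma continuousAt_ite_fst_eq_zero {F : ℝ × ℝ → ℝ} {c : ℝ × ℝ → ℝ} {w : ℝ}
    (hc : ContinuousAt c (0, w))
    (h : Tendsto F (𝓝[{q | q.1 ≠ 0}] (0, w)) (𝓝 (c (0, w)))) :
    ContinuousAt (fun q : ℝ × ℝ => if q.1 = 0 then c q else F q) (0, w) := by
  rw [ContinuousAt, if_pos rfl]
  exact Tendsto.if (hc.mono_left inf_le_left) h

lemma continuousAt_neg_snd_div {p : ℝ × ℝ} (hp : p.1 ≠ 0) :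
    ContinuousAt (fun q : ℝ × ℝ => -q.2 / q.1 ^ 2) p :=
  continuousAt_snd.neg.div (continuousAt_fst.pow 2) (pow_ne_zero 2 hp)

lemma hasDerivAt_neg_div_sq (w : ℝ) {e : ℝ} (he : e ≠ 0) :
    HasDerivAt (fun e : ℝ => -w / e ^ 2) (2 * w / e ^ 3) e := by
  refine ((hasDerivAt_const e (-w)).div (hasDerivAt_pow 2 e) (pow_ne_zero 2 he)).congr_deriv ?_
  field_simp
  ring

lemma hasDerivAt_neg_div (e w : ℝ) :
    HasDerivAt (fun w : ℝ => -w / e ^ 2) (-1 / e ^ 2) w :=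
  (hasDerivAt_neg w).div_const (e ^ 2)

/-- (Continuous differentiability of the perturbation, 1-d.)
With `ρ(ε,w) = ε²ℓ(-w/ε²)` for `ε ≠ 0` and `ρ(0,w) = max {-w, 0}`:
the first partial derivatives of `ρ` exist and are continuous except at `(0,0)`;
the second partials `∂²ρ/∂w²`, `∂²ρ/∂ε∂w`, `∂²ρ/∂w∂ε` are continuous except at `(0,0)`;
and `∂²ρ/∂ε²` is continuous on `{w > 0}`. -/
theorem perturbation_cont_diff_one_dim
    (ℓ : ℝ → ℝ) (hA : AssumptionA ℓ)
    (ρ : ℝ → ℝ → ℝ)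
    (hρ : ∀ ε w, ρ ε w = if ε = 0 then max (-w) 0 else ε ^ 2 * ℓ (-w / ε ^ 2)) :
    -- first partial derivatives exist off (0,0)
    (∀ p : ℝ × ℝ, p ≠ (0, 0) →
      DifferentiableAt ℝ (fun e => ρ e p.2) p.1 ∧ DifferentiableAt ℝ (ρ p.1) p.2) ∧
    -- and are continuous off (0,0)
    ContinuousOn (fun p : ℝ × ℝ => deriv (fun e => ρ e p.2) p.1) {p | p ≠ (0, 0)} ∧
    ContinuousOn (fun p : ℝ × ℝ => deriv (ρ p.1) p.2) {p | p ≠ (0, 0)} ∧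
    -- ∂²ρ/∂w² is continuous off (0,0)
    ContinuousOn (fun p : ℝ × ℝ => deriv (deriv (ρ p.1)) p.2) {p | p ≠ (0, 0)} ∧
    -- ∂²ρ/∂ε∂w is continuous off (0,0)
    ContinuousOn (fun p : ℝ × ℝ => deriv (fun e => deriv (ρ e) p.2) p.1) {p | p ≠ (0, 0)} ∧
    -- ∂²ρ/∂w∂ε is continuous off (0,0)
    ContinuousOn (fun p : ℝ × ℝ => deriv (fun v => deriv (fun e => ρ e v) p.1) p.2)
      {p | p ≠ (0, 0)} ∧
    -- ∂²ρ/∂ε² is continuous on {w > 0}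
    ContinuousOn (fun p : ℝ × ℝ => deriv (fun e => deriv (fun e' => ρ e' p.2) e) p.1)
      {p | 0 < p.2} := by
  have hℓc : Continuous ℓ := hA.smooth.continuous
  have hℓ'c : Continuous (deriv ℓ) := hA.contDiff_deriv.continuous
  have hℓ''c := hA.continuous_deriv_deriv
  have hoff : IsOpen {p : ℝ × ℝ | p ≠ (0, 0)} := isOpen_ne
  have hcases : ∀ p : ℝ × ℝ, p ≠ (0, 0) → p.1 ≠ 0 ∨ ∃ w, w ≠ 0 ∧ p = (0, w) := by
    rintro ⟨e, w⟩ hp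
    by_cases he : e = 0
    · exact Or.inr ⟨w, fun hw => hp (by rw [he, hw]), by rw [he]⟩
    · exact Or.inl he
  have hsgn : ∀ w : ℝ, w ≠ 0 → ∀ᶠ v in 𝓝 w, (if v < 0 then (1 : ℝ) else 0) =
      if w < 0 then 1 else 0 := by
    intro w hw
    rcases hw.lt_or_gt with hw | hw
    · filter_upwards [gt_mem_nhds hw] with v hv
      rw [if_pos hv, if_pos hw]
    · filter_upwards [lt_mem_nhds hw] with v hv
      rw [if_neg (not_lt.2 hv.le), if_neg (not_lt.2 hw.le)]
  let h : ℝ → ℝ := fun x => ℓ x - x * deriv ℓ x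
  have hhc : Continuous h := by fun_prop
  let Ge : ℝ × ℝ → ℝ := fun q => if q.1 = 0 then 0 else 2 * (q.1 * h (-q.2 / q.1 ^ 2))
  let Gw : ℝ × ℝ → ℝ := fun q =>
    if q.1 = 0 then -(if q.2 < 0 then 1 else 0) else -deriv ℓ (-q.2 / q.1 ^ 2)
  let Gww : ℝ × ℝ → ℝ := fun q =>
    if q.1 = 0 then 0 else deriv (deriv ℓ) (-q.2 / q.1 ^ 2) / q.1 ^ 2
  let Gew : ℝ × ℝ → ℝ := fun q =>
    if q.1 = 0 then 0 else -(2 * q.2 * deriv (deriv ℓ) (-q.2 / q.1 ^ 2) / q.1 ^ 3)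
  let Gee : ℝ × ℝ → ℝ := fun q => if q.1 = 0 then 0 else
    2 * h (-q.2 / q.1 ^ 2) + 4 * ((-q.2 / q.1 ^ 2) ^ 2 * deriv (deriv ℓ) (-q.2 / q.1 ^ 2))
  -- Continuity of `ρ` and of the candidate partial derivatives.
  have cρ : ∀ w, w ≠ 0 → ContinuousAt (fun q : ℝ × ℝ => ρ q.1 q.2) (0, w) := by
    intro w hw
    simp only [hρ]
    refine continuousAt_ite_fst_eq_zero (c := fun q => max (-q.2) 0)
      (F := fun q => q.1 ^ 2 * ℓ (-q.2 / q.1 ^ 2)) (by fun_prop) ?_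
    have h1 := ((tendsto_fst_nhdsWithin w _).mul (hA.tendsto_fst_mul_comp hw)).sub
      ((tendsto_snd_nhdsWithin w _).mul (hA.tendsto_deriv_comp hw))
    have h2 : 0 * 0 - w * (if w < 0 then (1 : ℝ) else 0) = max (-w) 0 := by
      rcases hw.lt_or_gt with hw | hw
      · rw [if_pos hw, max_eq_left (by linarith)]
        ring
      · rw [if_neg hw.not_gt, max_eq_right (by linarith)]
        ring
    rw [h2] at h1
    refine h1.congr' ?_
    filter_upwards [self_mem_nhdsWithin] with q (hq : q.1 ≠ 0)
    field_simp
    ring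
  have cGe : ∀ p : ℝ × ℝ, p ≠ (0, 0) → ContinuousAt Ge p := by
    intro p hp
    rcases hcases p hp with hp | ⟨w, hw, rfl⟩
    · have hz := continuousAt_neg_snd_div hp
      exact continuousAt_ite_fst_eq_zero_of_ne hp (by fun_prop)
    · refine continuousAt_ite_fst_eq_zero (c := fun _ => 0) continuousAt_const ?_
      simpa using (hA.tendsto_fst_mul_comp hw).const_mul 2
  have cGw : ∀ p : ℝ × ℝ, p ≠ (0, 0) → ContinuousAt Gw p := by
    intro p hp
    rcases hcases p hp with hp | ⟨w, hw, rfl⟩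
    · have hz := continuousAt_neg_snd_div hp
      exact continuousAt_ite_fst_eq_zero_of_ne hp (by fun_prop)
    · refine continuousAt_ite_fst_eq_zero (c := fun q => -(if q.2 < 0 then 1 else 0)) ?_
        (hA.tendsto_deriv_comp hw).neg
      refine ContinuousAt.neg (ContinuousAt.congr
        (continuousAt_const (y := if w < 0 then (1 : ℝ) else 0)) ?_)
      filter_upwards [(continuousAt_snd (p := ((0 : ℝ), w))).eventually (hsgn w hw)] with q hq
      exact hq.symm
  have cGww : ∀ p : ℝ × ℝ, p ≠ (0, 0) → ContinuousAt Gww p := by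
    intro p hp
    rcases hcases p hp with hp | ⟨w, hw, rfl⟩
    · have hz := continuousAt_neg_snd_div hp
      exact continuousAt_ite_fst_eq_zero_of_ne hp
        (ContinuousAt.div (by fun_prop) (by fun_prop) (pow_ne_zero 2 hp))
    · refine continuousAt_ite_fst_eq_zero (c := fun _ => 0) continuousAt_const ?_
      have h1 := (((tendsto_fst_nhdsWithin w _).pow 2).mul (hA.tendsto_sq_mul_comp hw)).div
        ((tendsto_snd_nhdsWithin w _).pow 2) (pow_ne_zero 2 hw)
      simp only [mul_zero, zero_div] at h1
      refine h1.congr' ?_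
      filter_upwards [self_mem_nhdsWithin, (tendsto_snd_nhdsWithin w _).eventually_ne hw]
        with q (hq : q.1 ≠ 0) hq2
      simp only [Pi.div_apply]
      field_simp
  have cGew : ∀ p : ℝ × ℝ, p ≠ (0, 0) → ContinuousAt Gew p := by
    intro p hp
    rcases hcases p hp with hp | ⟨w, hw, rfl⟩
    · have hz := continuousAt_neg_snd_div hp
      exact continuousAt_ite_fst_eq_zero_of_ne hp
        (ContinuousAt.neg (ContinuousAt.div (by fun_prop) (by fun_prop) (pow_ne_zero 3 hp)))
    · refine continuousAt_ite_fst_eq_zero (c := fun _ => 0) continuousAt_const ?_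
      have h1 := (((tendsto_fst_nhdsWithin w _).mul (hA.tendsto_sq_mul_comp hw)).const_mul
        (-2)).div (tendsto_snd_nhdsWithin w _) hw
      simp only [mul_zero, zero_div] at h1
      refine h1.congr' ?_
      filter_upwards [self_mem_nhdsWithin, (tendsto_snd_nhdsWithin w _).eventually_ne hw]
        with q (hq : q.1 ≠ 0) hq2
      simp only [Pi.div_apply]
      field_simp
  have cGee : ∀ p : ℝ × ℝ, 0 < p.2 → ContinuousAt Gee p := by
    rintro ⟨e, w⟩ (hw : 0 < w)
    by_cases he : e = 0
    · subst he
      refine continuousAt_ite_fst_eq_zero (c := fun _ => 0) continuousAt_const ?_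
      simpa using ((hA.tendsto_sub_mul_deriv_atBot.comp
        (tendsto_neg_snd_div_atBot hw)).const_mul 2).add
          ((hA.tendsto_sq_mul_comp hw.ne').const_mul 4)
    · have hz := continuousAt_neg_snd_div (p := (e, w)) he
      exact continuousAt_ite_fst_eq_zero_of_ne he (by fun_prop)
  have hpair : ∀ e w : ℝ, ContinuousAt (fun e' : ℝ => (e', w)) e := fun e w => by fun_prop
  -- The candidates are the partial derivatives.
  have dρe : ∀ p : ℝ × ℝ, p ≠ (0, 0) → HasDerivAt (fun e => ρ e p.2) (Ge p) p.1 := by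
    have hne : ∀ w e : ℝ, e ≠ 0 → HasDerivAt (fun e => ρ e w) (Ge (e, w)) e := by
      intro w e he
      have h1 := (hasDerivAt_pow 2 e).mul
        ((hA.hasDerivAt (-w / e ^ 2)).comp e (hasDerivAt_neg_div_sq w he))
      refine (h1.congr_of_eventuallyEq ?_).congr_deriv ?_
      · filter_upwards [eventually_ne_nhds he] with e' he'
        simp [hρ, he']
      · simp only [Ge, h, if_neg he, Function.comp_apply]
        field_simp
        ring
    intro p hp
    rcases hcases p hp with h1 | ⟨w, hw, rfl⟩
    · exact hne p.2 p.1 h1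
    · exact hasDerivAt_of_hasDerivAt_of_ne (g := fun e => Ge (e, w)) (hne w)
        (ContinuousAt.comp (f := fun e : ℝ => (e, w)) (cρ w hw) (hpair 0 w))
        (ContinuousAt.comp (f := fun e : ℝ => (e, w)) (cGe (0, w) hp) (hpair 0 w))
  have dρw : ∀ p : ℝ × ℝ, p ≠ (0, 0) → HasDerivAt (ρ p.1) (Gw p) p.2 := by
    intro p hp
    rcases hcases p hp with h1 | ⟨w, hw, rfl⟩
    · have h2 := ((hA.hasDerivAt (-p.2 / p.1 ^ 2)).comp p.2
        (hasDerivAt_neg_div p.1 p.2)).const_mul (p.1 ^ 2)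
      refine (h2.congr_of_eventuallyEq (Eventually.of_forall fun v => ?_)).congr_deriv ?_
      · simp [hρ, h1]
      · simp only [Gw, if_neg h1]
        field_simp
    · rcases hw.lt_or_gt with hw | hw
      · refine ((hasDerivAt_neg w).congr_of_eventuallyEq ?_).congr_deriv ?_
        · filter_upwards [gt_mem_nhds hw] with v hv
          simp [hρ, hv.le]
        · simp [Gw, hw]
      · refine ((hasDerivAt_const w (0 : ℝ)).congr_of_eventuallyEq ?_).congr_deriv ?_
        · filter_upwards [lt_mem_nhds hw] with v hv
          simp [hρ, hv.le]
        · simp [Gw, hw.le]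
  have dGww : ∀ p : ℝ × ℝ, p ≠ (0, 0) → HasDerivAt (fun v => Gw (p.1, v)) (Gww p) p.2 := by
    intro p hp
    rcases hcases p hp with h1 | ⟨w, hw, rfl⟩
    · have h2 := ((hA.hasDerivAt_deriv (-p.2 / p.1 ^ 2)).comp p.2
        (hasDerivAt_neg_div p.1 p.2)).neg
      refine (h2.congr_of_eventuallyEq (Eventually.of_forall fun v => ?_)).congr_deriv ?_
      · simp [Gw, h1]
      · simp only [Gww, if_neg h1]
        field_simp
    · refine ((hasDerivAt_const w (-(if w < 0 then (1 : ℝ) else 0))).congr_of_eventuallyEq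
        ?_).congr_deriv ?_
      · filter_upwards [hsgn w hw] with v hv
        simp only [Gw, if_true, hv]
      · simp [Gww]
  have dGew : ∀ p : ℝ × ℝ, p ≠ (0, 0) → HasDerivAt (fun e => Gw (e, p.2)) (Gew p) p.1 := by
    have hne : ∀ w e : ℝ, e ≠ 0 → HasDerivAt (fun e => Gw (e, w)) (Gew (e, w)) e := by
      intro w e he
      have h1 := ((hA.hasDerivAt_deriv (-w / e ^ 2)).comp e (hasDerivAt_neg_div_sq w he)).neg
      refine (h1.congr_of_eventuallyEq ?_).congr_deriv ?_
      · filter_upwards [eventually_ne_nhds he] with e' he'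
        simp [Gw, he']
      · simp only [Gew, if_neg he]
        field_simp
    intro p hp
    rcases hcases p hp with h1 | ⟨w, hw, rfl⟩
    · exact hne p.2 p.1 h1
    · exact hasDerivAt_of_hasDerivAt_of_ne (g := fun e => Gew (e, w)) (hne w)
        (ContinuousAt.comp (f := fun e : ℝ => (e, w)) (cGw (0, w) hp) (hpair 0 w))
        (ContinuousAt.comp (f := fun e : ℝ => (e, w)) (cGew (0, w) hp) (hpair 0 w))
  have dGwe : ∀ p : ℝ × ℝ, HasDerivAt (fun v => Ge (p.1, v)) (Gew p) p.2 := by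
    intro p
    by_cases h1 : p.1 = 0
    · simpa only [Ge, Gew, if_pos h1] using hasDerivAt_const p.2 (0 : ℝ)
    · have h2 := (((hA.hasDerivAt_sub_mul_deriv (-p.2 / p.1 ^ 2)).comp p.2
        (hasDerivAt_neg_div p.1 p.2)).const_mul p.1).const_mul 2
      refine (h2.congr_of_eventuallyEq (Eventually.of_forall fun v => ?_)).congr_deriv ?_
      · simp [Ge, h, h1]
      · simp only [Gew, if_neg h1]
        field_simp
  have dGee : ∀ p : ℝ × ℝ, 0 < p.2 → HasDerivAt (fun e => Ge (e, p.2)) (Gee p) p.1 := by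
    have hne : ∀ w e : ℝ, e ≠ 0 → HasDerivAt (fun e => Ge (e, w)) (Gee (e, w)) e := by
      intro w e he
      have h1 := ((hasDerivAt_id e).mul ((hA.hasDerivAt_sub_mul_deriv (-w / e ^ 2)).comp e
        (hasDerivAt_neg_div_sq w he))).const_mul 2
      refine (h1.congr_of_eventuallyEq ?_).congr_deriv ?_
      · filter_upwards [eventually_ne_nhds he] with e' he'
        simp [Ge, h, he']
      · simp only [Gee, h, if_neg he, Function.comp_apply, id]
        field_simp
        ring
    rintro ⟨e, w⟩ (hw : 0 < w)
    by_cases he : e = 0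
    · subst he
      have hp : ((0 : ℝ), w) ≠ (0, 0) := by simp [hw.ne']
      exact hasDerivAt_of_hasDerivAt_of_ne (g := fun e => Gee (e, w)) (hne w)
        (ContinuousAt.comp (f := fun e : ℝ => (e, w)) (cGe (0, w) hp) (hpair 0 w))
        (ContinuousAt.comp (f := fun e : ℝ => (e, w)) (cGee (0, w) hw) (hpair 0 w))
    · exact hne w e he
  have evfst : ∀ p : ℝ × ℝ, p ≠ (0, 0) → ∀ᶠ e in 𝓝 p.1, (e, p.2) ≠ ((0 : ℝ), (0 : ℝ)) :=
    fun p hp => (hpair p.1 p.2).eventually (hoff.mem_nhds hp)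
  have evsnd : ∀ p : ℝ × ℝ, p ≠ (0, 0) → ∀ᶠ v in 𝓝 p.2, (p.1, v) ≠ ((0 : ℝ), (0 : ℝ)) :=
    fun p hp => (show ContinuousAt (fun v : ℝ => (p.1, v)) p.2 by fun_prop).eventually
      (hoff.mem_nhds hp)
  have con : ∀ {s : Set (ℝ × ℝ)} {F G : ℝ × ℝ → ℝ}, (∀ p ∈ s, ContinuousAt G p) →
      (∀ p ∈ s, F p = G p) → ContinuousOn F s := fun hG hFG =>
    ContinuousOn.congr (fun p hp => (hG p hp).continuousWithinAt) hFG
  refine ⟨fun p hp => ⟨(dρe p hp).differentiableAt, (dρw p hp).differentiableAt⟩,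
    con cGe fun p hp => (dρe p hp).deriv, con cGw fun p hp => (dρw p hp).deriv,
    con cGww fun p hp => ?_, con cGew fun p hp => ?_, con cGew fun p hp => ?_,
    con cGee fun p hp => ?_⟩
  · refine ((dGww p hp).congr_of_eventuallyEq ?_).deriv
    filter_upwards [evsnd p hp] with v hv
    exact (dρw (p.1, v) hv).deriv
  · refine ((dGew p hp).congr_of_eventuallyEq ?_).deriv
    filter_upwards [evfst p hp] with e he
    exact (dρw (e, p.2) he).deriv
  · refine ((dGwe p).congr_of_eventuallyEq ?_).deriv
    filter_upwards [evsnd p hp] with v hv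
    exact (dρe (p.1, v) hv).deriv
  · have hp0 : p ≠ (0, 0) := fun h0 => by simp [h0] at hp
    refine ((dGee p hp).congr_of_eventuallyEq ?_).deriv
    filter_upwards [evfst p hp0] with e he
    exact (dρe (e, p.2) he).deriv
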